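/- Suppose the star-connected occupied component C(0) containing the origin is finite and nonempty, and let S_{k_1}, S_{k_2} ∈ C(0) be occupied squares whose outermost boundary cycles satisfy D_{k_1} ≠ D_{k_2}. Then the cycles D_{k_1} and D_{k_2} have disjoint interiors and share at most one vertex. -/

import Mathlib

/-!
Common framework: tile ℝ² into closed unit squares indexed by `ℤ²`, with corners
forming a translate of `ℤ²` and the origin the centre of the square `S₀` (index `(0,0)`).
A cycle is identified with its edge set (a set of unordered pairs of corners);
its interior (resp. exterior) is the union of the bounded (resp. unbounded)
connected components of the complement of the closed curve it traces in the plane.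
-/

/-- Corners of the grid squares, indexed by `ℤ²`. -/
abbrev GridV := ℤ × ℤ

/-- Embedding of corners into the plane: the square of index `z` is
`[z₁ - 1/2, z₁ + 1/2] × [z₂ - 1/2, z₂ + 1/2]`, so the origin is the centre of `S₀`. -/
noncomputable def toPlane (v : GridV) : ℝ × ℝ := ((v.1 : ℝ) - 1 / 2, (v.2 : ℝ) - 1 / 2)

/-- The closed unit square of index `z`. -/
def squareSet (z : GridV) : Set (ℝ × ℝ) :=
  Set.Icc ((z.1 : ℝ) - 1 / 2, (z.2 : ℝ) - 1 / 2) ((z.1 : ℝ) + 1 / 2, (z.2 : ℝ) + 1 / 2)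

/-- The four edges (unit segments) of the square of index `z`, as unordered pairs of corners. -/
def squareEdges (z : GridV) : Set (Sym2 GridV) :=
  {s(z, z + (1, 0)), s(z + (1, 0), z + (1, 1)), s(z + (1, 1), z + (0, 1)), s(z + (0, 1), z)}

/-- Adjacency of corners in the full grid graph `G`: Euclidean distance one. -/
def GridAdj (u v : GridV) : Prop := |u.1 - v.1| + |u.2 - v.2| = 1

/-- A cycle in the full grid graph: a cyclic sequence `(v₀, …, v_{n-1}, v₀)` of
distinct corners with consecutive corners adjacent. -/
structure GridCycle where
  n : ℕ
  hn : 3 ≤ n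
  f : ZMod n → GridV
  inj : Function.Injective f
  adj : ∀ i, GridAdj (f i) (f (i + 1))

/-- The edge set of a grid cycle. -/
def GridCycle.edgeSet (C : GridCycle) : Set (Sym2 GridV) :=
  {e | ∃ i : ZMod C.n, e = s(C.f i, C.f (i + 1))}

/-- An edge set is (the edge set of) a cycle of the grid graph `G`.
We identify a cycle with its edge set. -/
def IsCycle (E : Set (Sym2 GridV)) : Prop := ∃ C : GridCycle, C.edgeSet = E

/-- A cycle of the subgraph of the grid graph with edge set `G`. -/
def IsCycleIn (G E : Set (Sym2 GridV)) : Prop := IsCycle E ∧ E ⊆ G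

/-- The vertices incident to some edge of `E`. -/
def vertexSetOf (E : Set (Sym2 GridV)) : Set GridV := {v | ∃ e ∈ E, v ∈ e}

/-- The closed segment in the plane realizing an edge. -/
noncomputable def edgeSeg : Sym2 GridV → Set (ℝ × ℝ) :=
  Sym2.lift ⟨fun a b => segment ℝ (toPlane a) (toPlane b), fun _ _ => segment_symm ℝ _ _⟩

/-- The closed curve in the plane traced by the edges of `E`. -/
noncomputable def carrierOf (E : Set (Sym2 GridV)) : Set (ℝ × ℝ) := ⋃ e ∈ E, edgeSeg e

/-- The interior of a cycle: the union of the bounded connected components of the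
complement of its carrier curve. -/
noncomputable def interiorOf (E : Set (Sym2 GridV)) : Set (ℝ × ℝ) :=
  {p | p ∉ carrierOf E ∧ Bornology.IsBounded (connectedComponentIn (carrierOf E)ᶜ p)}

/-- The exterior of a cycle: the union of the unbounded connected components of the
complement of its carrier curve. -/
noncomputable def exteriorOf (E : Set (Sym2 GridV)) : Set (ℝ × ℝ) :=
  {p | p ∉ carrierOf E ∧ ¬ Bornology.IsBounded (connectedComponentIn (carrierOf E)ᶜ p)}

/-- The set `A` is contained in the interior of the cycle `E` (points of the
curve itself being allowed, so that e.g. a square whose boundary edges lie on the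
cycle counts as contained in the interior). -/
def inInterior (E : Set (Sym2 GridV)) (A : Set (ℝ × ℝ)) : Prop :=
  A ⊆ interiorOf E ∪ carrierOf E

/-- The set `A` lies in the exterior of the cycle `E` (points of the curve itself
being allowed). -/
def inExterior (E : Set (Sym2 GridV)) (A : Set (ℝ × ℝ)) : Prop :=
  A ⊆ exteriorOf E ∪ carrierOf E

/-- Star adjacency: distinct squares sharing at least a corner. -/
def starAdj (z w : GridV) : Prop := z ≠ w ∧ |z.1 - w.1| ≤ 1 ∧ |z.2 - w.2| ≤ 1

/-- Plus adjacency: squares sharing an edge. -/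
def plusAdj (z w : GridV) : Prop := |z.1 - w.1| + |z.2 - w.2| = 1

/-- The star-connected occupied component `C(0)` of the square `S₀` (of index `(0,0)`),
for the occupancy configuration `ω`; empty if `S₀` is vacant. -/
def starComp (ω : GridV → Prop) : Set GridV :=
  {z | ω z ∧ Relation.ReflTransGen (fun a b => ω a ∧ ω b ∧ starAdj a b) (0, 0) z}

/-- The plus-connected occupied component `C⁺(0)` of the square `S₀`. -/
def plusComp (ω : GridV → Prop) : Set GridV :=
  {z | ω z ∧ Relation.ReflTransGen (fun a b => ω a ∧ ω b ∧ plusAdj a b) (0, 0) z}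

/-- The edge set of the graph `G_C`: all edges of squares of `C(0)`. -/
def gcEdges (ω : GridV → Prop) : Set (Sym2 GridV) := ⋃ z ∈ starComp ω, squareEdges z

/-- The edge set of the graph `G⁺_C`: all edges of squares of `C⁺(0)`. -/
def gpcEdges (ω : GridV → Prop) : Set (Sym2 GridV) := ⋃ z ∈ plusComp ω, squareEdges z

/-- `e` is an outermost boundary edge of the graph with edge set `G`: for every
cycle `E` in this graph, either `e` is an edge of `E` or `e` lies in the exterior of `E`. -/
def outermostBoundaryEdgeIn (G : Set (Sym2 GridV)) (e : Sym2 GridV) : Prop :=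
  e ∈ G ∧ ∀ E, IsCycleIn G E → e ∈ E ∨ inExterior E (edgeSeg e)

/-- The subgraph spanned by the edge set `E` is connected: any two incident vertices
are joined by a walk using only edges of `E`. -/
def EdgeSetConnected (E : Set (Sym2 GridV)) : Prop :=
  ∀ u v, u ∈ vertexSetOf E → v ∈ vertexSetOf E →
    ∃ p : List GridV, p.head? = some u ∧ p.getLast? = some v ∧
      List.Chain' (fun a b => s(a, b) ∈ E) p

/-- `D` is the outermost boundary cycle `D_k` of the square of index `z` of the star
component `C(0)`: (a) the square lies in the interior of `D`; (b) every edge of `D` is a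
boundary edge adjacent to an occupied square of `C(0)` in the interior of `D` and to a
vacant square in the exterior of `D`; (c) every cycle of `G_C` containing the square in
its interior has all its edges on `D` or in the interior of `D`. -/
def isOutermostCycleOf (ω : GridV → Prop) (z : GridV) (D : Set (Sym2 GridV)) : Prop :=
  IsCycleIn (gcEdges ω) D ∧
  inInterior D (squareSet z) ∧
  (∀ e ∈ D,
    (∃ w ∈ starComp ω, e ∈ squareEdges w ∧ inInterior D (squareSet w)) ∧
    (∃ w, ¬ ω w ∧ e ∈ squareEdges w ∧ inExterior D (squareSet w))) ∧
  (∀ C, IsCycleIn (gcEdges ω) C → inInterior C (squareSet z) →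
    ∀ e ∈ C, e ∈ D ∨ inInterior D (edgeSeg e))

/-- The list of edges traversed by a walk given as a list of vertices. -/
def walkEdges (p : List GridV) : List (Sym2 GridV) :=
  List.zipWith (fun a b => s(a, b)) p p.tail


open scoped symmDiff

/-- The horizontal unit edge with left endpoint `(x, y)`. -/
def horizontalEdge (x y : ℤ) : Sym2 GridV := s((x, y), (x + 1, y))

/-- The vertical unit edge with lower endpoint `(x, y)`. -/
def verticalEdge (x y : ℤ) : Sym2 GridV := s((x, y), (x, y + 1))

/-- The edge set of the full grid graph. -/
def gridEdges : Set (Sym2 GridV) :=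
  {e | ∃ x y, e = horizontalEdge x y ∨ e = verticalEdge x y}

theorem horizontalEdge_mem_gridEdges (x y : ℤ) : horizontalEdge x y ∈ gridEdges :=
  ⟨x, y, .inl rfl⟩

theorem verticalEdge_mem_gridEdges (x y : ℤ) : verticalEdge x y ∈ gridEdges :=
  ⟨x, y, .inr rfl⟩

@[simp]
theorem horizontalEdge_inj {x y a b : ℤ} :
    horizontalEdge x y = horizontalEdge a b ↔ x = a ∧ y = b := by
  simp only [horizontalEdge, Sym2.eq_iff, Prod.mk.injEq]
  omega

@[simp]
theorem verticalEdge_inj {x y a b : ℤ} :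
    verticalEdge x y = verticalEdge a b ↔ x = a ∧ y = b := by
  simp only [verticalEdge, Sym2.eq_iff, Prod.mk.injEq]
  omega

@[simp]
theorem horizontalEdge_ne_verticalEdge {x y a b : ℤ} :
    horizontalEdge x y ≠ verticalEdge a b := by
  simp only [horizontalEdge, verticalEdge, ne_eq, Sym2.eq_iff, Prod.mk.injEq]
  omega

@[simp]
theorem verticalEdge_ne_horizontalEdge {x y a b : ℤ} :
    verticalEdge x y ≠ horizontalEdge a b :=
  horizontalEdge_ne_verticalEdge.symm

theorem GridAdj.mk_mem_gridEdges {u v : GridV} (h : GridAdj u v) : s(u, v) ∈ gridEdges := by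
  obtain ⟨a, b⟩ := u
  obtain ⟨c, d⟩ := v
  simp only [GridAdj] at h
  have : (c = a + 1 ∧ d = b) ∨ (a = c + 1 ∧ d = b) ∨ (c = a ∧ d = b + 1) ∨
      (c = a ∧ b = d + 1) := by
    rcases abs_cases (a - c) with h1 | h1 <;> rcases abs_cases (b - d) with h2 | h2 <;> omega
  rcases this with ⟨rfl, rfl⟩ | ⟨rfl, rfl⟩ | ⟨rfl, rfl⟩ | ⟨rfl, rfl⟩
  · exact ⟨a, d, .inl rfl⟩
  · exact ⟨c, d, .inl Sym2.eq_swap⟩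
  · exact ⟨c, b, .inr rfl⟩
  · exact ⟨c, d, .inr Sym2.eq_swap⟩

theorem gridAdj_of_mem_gridEdges {u v : GridV} (h : s(u, v) ∈ gridEdges) : GridAdj u v := by
  obtain ⟨x, y, h | h⟩ := h <;> simp only [horizontalEdge, verticalEdge, Sym2.eq_iff] at h <;>
    rcases h with ⟨rfl, rfl⟩ | ⟨rfl, rfl⟩ <;> simp [GridAdj]

theorem IsCycle.subset_gridEdges {E : Set (Sym2 GridV)} (h : IsCycle E) : E ⊆ gridEdges := by
  obtain ⟨C, rfl⟩ := h
  rintro _ ⟨i, rfl⟩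
  exact (C.adj i).mk_mem_gridEdges

section Parity

open scoped Classical in
/-- The mod-2 indicator of a set. -/
noncomputable def modTwoIndicator {α : Type*} (S : Set α) (a : α) : ZMod 2 :=
  if a ∈ S then 1 else 0

theorem modTwoIndicator_eq_one {α : Type*} {S : Set α} {a : α} :
    modTwoIndicator S a = 1 ↔ a ∈ S := by
  by_cases h : a ∈ S <;> simp [modTwoIndicator, h]

theorem modTwoIndicator_eq_zero {α : Type*} {S : Set α} {a : α} :
    modTwoIndicator S a = 0 ↔ a ∉ S := by
  by_cases h : a ∈ S <;> simp [modTwoIndicator, h]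

theorem modTwoIndicator_symmDiff {α : Type*} (S T : Set α) (a : α) :
    modTwoIndicator (S ∆ T) a = modTwoIndicator S a + modTwoIndicator T a := by
  by_cases h : a ∈ S <;> by_cases h' : a ∈ T <;>
    simp [modTwoIndicator, h, h', Set.mem_symmDiff, CharTwo.add_self_eq_zero]

/-- The degree mod 2 of the corner `v` in the grid subgraph with edge set `S`. -/
noncomputable def degreeModTwo (S : Set (Sym2 GridV)) (v : GridV) : ZMod 2 :=
  modTwoIndicator S (horizontalEdge v.1 v.2) + modTwoIndicator S (horizontalEdge (v.1 - 1) v.2) +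
    modTwoIndicator S (verticalEdge v.1 v.2) + modTwoIndicator S (verticalEdge v.1 (v.2 - 1))

/-- Every corner has even degree in `S`. -/
def IsEvenEdgeSet (S : Set (Sym2 GridV)) : Prop := ∀ v, degreeModTwo S v = 0

theorem degreeModTwo_symmDiff (S T : Set (Sym2 GridV)) (v : GridV) :
    degreeModTwo (S ∆ T) v = degreeModTwo S v + degreeModTwo T v := by
  simp only [degreeModTwo, modTwoIndicator_symmDiff]
  ring

theorem IsEvenEdgeSet.symmDiff {S T : Set (Sym2 GridV)} (hS : IsEvenEdgeSet S)
    (hT : IsEvenEdgeSet T) : IsEvenEdgeSet (S ∆ T) := fun v ↦ by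
  rw [degreeModTwo_symmDiff, hS, hT, add_zero]

theorem degreeModTwo_empty (v : GridV) : degreeModTwo ∅ v = 0 := by
  simp [degreeModTwo, modTwoIndicator]

theorem degreeModTwo_singleton {a b : GridV} (h : GridAdj a b) (v : GridV) :
    degreeModTwo {s(a, b)} v = (if v = a then 1 else 0) + (if v = b then 1 else 0) := by
  obtain ⟨p, q⟩ := v
  obtain ⟨x, y, he⟩ := h.mk_mem_gridEdges
  have key : degreeModTwo {s(a, b)} (p, q) =
      (if (p, q) ∈ s(a, b) then 1 else 0) := by
    rcases he with he | he
    · rw [he]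
      simp only [degreeModTwo, modTwoIndicator, Set.mem_singleton_iff, horizontalEdge_inj,
        verticalEdge_ne_horizontalEdge, if_false, add_zero]
      simp only [horizontalEdge, Sym2.mem_iff, Prod.mk.injEq]
      split_ifs <;> first | omega | simp
    · rw [he]
      simp only [degreeModTwo, modTwoIndicator, Set.mem_singleton_iff, verticalEdge_inj,
        horizontalEdge_ne_verticalEdge, if_false, zero_add]
      simp only [verticalEdge, Sym2.mem_iff, Prod.mk.injEq]
      split_ifs <;> first | omega | simp
  have hab : a ≠ b := by
    rintro rfl
    simp [GridAdj] at h
  rw [key]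
  simp only [Sym2.mem_iff]
  by_cases h1 : (p, q) = a
  · simp [h1, hab]
  · simp [h1]

end Parity

section Cycles

/-- The `i`-th edge of a grid cycle. -/
def GridCycle.edge (C : GridCycle) (i : ZMod C.n) : Sym2 GridV := s(C.f i, C.f (i + 1))

instance (C : GridCycle) : NeZero C.n := ⟨by have := C.hn; omega⟩

theorem GridCycle.edge_injective (C : GridCycle) : Function.Injective C.edge := by
  intro i j h
  simp only [edge, Sym2.eq_iff, C.inj.eq_iff] at h
  rcases h with h | ⟨h1, h2⟩
  · exact h.1
  · exfalso
    have h3 : ((2 : ℕ) : ZMod C.n) = 0 := by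
      push_cast
      linear_combination h2 - h1
    rw [ZMod.natCast_eq_zero_iff] at h3
    have := Nat.le_of_dvd (by norm_num) h3
    have := C.hn
    omega

theorem GridCycle.edgeSet_eq_range (C : GridCycle) : C.edgeSet = Set.range C.edge := by
  ext e
  simp [edgeSet, edge, eq_comm]

theorem IsCycle.finite {E : Set (Sym2 GridV)} (h : IsCycle E) : E.Finite := by
  obtain ⟨C, rfl⟩ := h
  rw [C.edgeSet_eq_range]
  exact Set.finite_range _

theorem IsCycle.nonempty {E : Set (Sym2 GridV)} (h : IsCycle E) : E.Nonempty := by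
  obtain ⟨C, rfl⟩ := h
  exact ⟨_, 0, rfl⟩

theorem GridCycle.degreeModTwo_image_edge (C : GridCycle) (J : Finset (ZMod C.n)) (v : GridV) :
    degreeModTwo (C.edge '' J) v =
      ∑ i ∈ J, ((if v = C.f i then 1 else 0) + (if v = C.f (i + 1) then 1 else 0)) := by
  classical
  induction J using Finset.induction_on with
  | empty => simp [degreeModTwo_empty]
  | insert i J hi ih =>
    have : C.edge '' (insert i J : Finset (ZMod C.n)) = {s(C.f i, C.f (i + 1))} ∆ (C.edge '' J) := by
      have hd : Disjoint {s(C.f i, C.f (i + 1))} (C.edge '' (J : Set (ZMod C.n))) := by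
        rw [Set.disjoint_singleton_left]
        rintro ⟨j, hj, hji⟩
        exact hi (C.edge_injective hji ▸ hj)
      rw [hd.symmDiff_eq_sup, Finset.coe_insert, Set.image_insert_eq]
      rfl
    rw [this, degreeModTwo_symmDiff, degreeModTwo_singleton (C.adj i), ih, Finset.sum_insert hi]

theorem IsCycle.isEvenEdgeSet {E : Set (Sym2 GridV)} (h : IsCycle E) : IsEvenEdgeSet E := by
  obtain ⟨C, rfl⟩ := h
  intro v
  have h1 := C.degreeModTwo_image_edge Finset.univ v
  rw [Finset.coe_univ, Set.image_univ, ← C.edgeSet_eq_range] at h1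
  have h2 : ∑ i, (if v = C.f (i + 1) then (1 : ZMod 2) else 0) = ∑ i, if v = C.f i then 1 else 0 :=
    Equiv.sum_comp (Equiv.addRight (1 : ZMod C.n)) (fun i ↦ if v = C.f i then (1 : ZMod 2) else 0)
  rw [h1, Finset.sum_add_distrib, h2, CharTwo.add_self_eq_zero]

/-- A nonempty even subset of a cycle is the whole cycle. -/
theorem IsCycle.eq_of_isEvenEdgeSet_subset {E S : Set (Sym2 GridV)} (h : IsCycle E)
    (hS : IsEvenEdgeSet S) (hSE : S ⊆ E) (hne : S.Nonempty) : S = E := by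
  classical
  obtain ⟨C, rfl⟩ := h
  rw [C.edgeSet_eq_range] at hSE ⊢
  set J : Finset (ZMod C.n) := {i | C.edge i ∈ S} with hJ
  have hSJ : S = C.edge '' J := by
    ext e
    constructor
    · intro he
      obtain ⟨i, rfl⟩ := hSE he
      exact ⟨i, by simpa [hJ] using he, rfl⟩
    · rintro ⟨i, hi, rfl⟩
      simpa [hJ] using hi
  have step : ∀ i, i ∈ J → i + 1 ∈ J := by
    intro i hi
    have h1 := C.degreeModTwo_image_edge J (C.f (i + 1))
    rw [← hSJ, hS, Finset.sum_add_distrib] at h1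
    simp only [C.inj.eq_iff, add_left_inj, Finset.sum_ite_eq, hi, if_true] at h1
    by_contra h2
    simp [h2] at h1
  have all : ∀ (k : ℕ) i, i ∈ J → i + k ∈ J := by
    intro k
    induction k with
    | zero => intro i hi; simpa using hi
    | succ k ih =>
      intro i hi
      have := step _ (ih i hi)
      push_cast
      rwa [← add_assoc]
  obtain ⟨e, he⟩ := hne
  obtain ⟨i, rfl⟩ := hSE he
  refine hSE.antisymm ?_
  rintro _ ⟨j, rfl⟩
  have := all (j - i).val i (by simpa [hJ] using he)
  rw [ZMod.natCast_val, ZMod.cast_id', id, add_sub_cancel] at this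
  simpa [hJ] using this

theorem IsCycle.eq_of_subset {E S : Set (Sym2 GridV)} (h : IsCycle E) (hS : IsCycle S)
    (hSE : S ⊆ E) : S = E :=
  h.eq_of_isEvenEdgeSet_subset hS.isEvenEdgeSet hSE hS.nonempty

/-- Two distinct vertices of a cycle are joined by a path forming a proper part of the cycle. -/
theorem IsCycle.exists_ssubset_degreeModTwo {E : Set (Sym2 GridV)} (h : IsCycle E) {u v : GridV}
    (hu : u ∈ vertexSetOf E) (hv : v ∈ vertexSetOf E) (huv : u ≠ v) :
    ∃ P ⊂ E, ∀ x, degreeModTwo P x = (if x = u then 1 else 0) + (if x = v then 1 else 0) := by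
  classical
  obtain ⟨C, rfl⟩ := h
  have hvert : ∀ w ∈ vertexSetOf C.edgeSet, ∃ i, C.f i = w := by
    rintro w ⟨_, ⟨i, rfl⟩, hw⟩
    rw [Sym2.mem_iff] at hw
    rcases hw with rfl | rfl
    exacts [⟨i, rfl⟩, ⟨i + 1, rfl⟩]
  obtain ⟨a, rfl⟩ := hvert u hu
  obtain ⟨b, rfl⟩ := hvert v hv
  have hab : a ≠ b := fun h ↦ huv (h ▸ rfl)
  set g : ℕ → ZMod C.n := fun j ↦ a + j with hg
  set k := (b - a).val with hk
  have hkn : k < C.n := ZMod.val_lt _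
  have hginj : Set.InjOn g (Finset.range k) := by
    intro i hi j hj hij
    simp only [Finset.coe_range, Set.mem_Iio] at hi hj
    have h1 : ((i : ℕ) : ZMod C.n) = (j : ℕ) := add_left_cancel hij
    rw [ZMod.natCast_eq_natCast_iff'] at h1
    rwa [Nat.mod_eq_of_lt (hi.trans hkn), Nat.mod_eq_of_lt (hj.trans hkn)] at h1
  have hgk : g k = b := by simp [hg, hk]
  have hdeg : ∀ x, degreeModTwo (C.edge '' ((Finset.range k).image g : Finset (ZMod C.n))) x =
      (if x = C.f a then 1 else 0) + (if x = C.f b then 1 else 0) := by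
    intro x
    rw [C.degreeModTwo_image_edge, Finset.sum_image hginj, ← hgk]
    have hg0 : (if x = C.f a then (1 : ZMod 2) else 0) = if x = C.f (g 0) then 1 else 0 := by
      simp [hg]
    have hgs : ∀ j, g j + 1 = g (j + 1) := fun j ↦ by simp only [hg]; push_cast; ring
    simp only [hg0, hgs]
    clear_value k
    clear hkn hginj hgk hk
    induction k with
    | zero => simp [CharTwo.add_self_eq_zero]
    | succ k ih =>
      rw [Finset.sum_range_succ, ih]
      have := CharTwo.add_self_eq_zero (if x = C.f (g k) then (1 : ZMod 2) else 0)
      linear_combination this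
  refine ⟨_, ?_, hdeg⟩
  rw [Set.ssubset_iff_subset_ne]
  constructor
  · rw [C.edgeSet_eq_range]
    exact Set.image_subset_range _ _
  · intro heq
    have h1 := hdeg (C.f a)
    rw [heq, (IsCycle.isEvenEdgeSet ⟨C, rfl⟩ : IsEvenEdgeSet C.edgeSet)] at h1
    simp [huv] at h1

end Cycles

section ExistsCycle

/-- A graph with finitely many edges, at least one edge and no vertex of degree one has a cycle. -/
theorem SimpleGraph.not_isAcyclic_of_exists_other_adj {V : Type*} (G : SimpleGraph V)
    [Finite G.edgeSet] {a b : V} (hab : G.Adj a b)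
    (h : ∀ u w, G.Adj u w → ∃ w', w' ≠ w ∧ G.Adj u w') : ¬ G.IsAcyclic := by
  intro hG
  have : Nonempty V := ⟨a⟩
  obtain ⟨u, v, p, hp, hmax⟩ := Walk.exists_isPath_forall_isPath_length_le_length G
  have hlen : 1 ≤ p.length := by
    simpa using hmax a b (Path.singleton hab).1 (Path.singleton hab).2
  have hnil : ¬ p.Nil := fun hn ↦ by
    rw [← Walk.length_eq_zero_iff] at hn
    omega
  obtain ⟨w, hw, hadj⟩ := h u p.snd (p.adj_snd hnil)
  have hws : w ∉ p.support := fun hs ↦ hw (hG.eq_snd_of_adj_start hp hadj hs)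
  have := hmax w v (Walk.cons hadj.symm p) (hp.cons hws)
  simp at this

theorem SimpleGraph.Walk.IsCycle.exists_gridCycle {G : SimpleGraph GridV}
    (hG : ∀ u v, G.Adj u v → GridAdj u v) {u : GridV} {p : G.Walk u u} (hp : p.IsCycle) :
    ∃ C : GridCycle, C.edgeSet ⊆ G.edgeSet := by
  have h3 := hp.three_le_length
  have : NeZero p.length := ⟨by omega⟩
  have : Fact (1 < p.length) := ⟨by omega⟩
  have hadj : ∀ i : ZMod p.length, G.Adj (p.getVert (ZMod.val i)) (p.getVert (ZMod.val (i + 1))) := by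
    intro i
    have hi := ZMod.val_lt i
    have h1 := p.adj_getVert_succ hi
    rcases Nat.lt_or_ge (ZMod.val i + 1) p.length with h | h
    · rwa [ZMod.val_add_of_lt (by rwa [ZMod.val_one]), ZMod.val_one]
    · have h2 : ZMod.val i + 1 = p.length := by omega
      have h4 : i + 1 = 0 := by
        have h5 : ((ZMod.val i + 1 : ℕ) : ZMod p.length) = 0 := by rw [h2, ZMod.natCast_self]
        rwa [Nat.cast_add, Nat.cast_one, ZMod.natCast_zmod_val] at h5
      rw [h4, ZMod.val_zero, Walk.getVert_zero]
      rwa [h2, Walk.getVert_length] at h1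
  refine ⟨⟨p.length, h3, fun i : ZMod p.length ↦ p.getVert (ZMod.val i), ?_, fun i ↦ hG _ _ (hadj i)⟩, ?_⟩
  · intro i j hij
    have hi := ZMod.val_lt i
    have hj := ZMod.val_lt j
    exact ZMod.val_injective _ (hp.getVert_injOn' (by simp; omega) (by simp; omega) hij)
  · rintro _ ⟨i, rfl⟩
    exact hadj i

theorem IsEvenEdgeSet.exists_isCycle_subset {S : Set (Sym2 GridV)} (hS : IsEvenEdgeSet S)
    (hgrid : S ⊆ gridEdges) (hfin : S.Finite) (hne : S.Nonempty) : ∃ C ⊆ S, IsCycle C := by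
  have hnd : S \ Sym2.diagSet = S := by
    refine sdiff_eq_left.2 (Set.disjoint_left.2 ?_)
    rintro ⟨a, b⟩ hab hd
    have := gridAdj_of_mem_gridEdges (hgrid hab)
    obtain rfl : a = b := hd
    simp [GridAdj] at this
  set G := SimpleGraph.fromEdgeSet S with hG
  have hGS : G.edgeSet = S := by rw [hG, SimpleGraph.edgeSet_fromEdgeSet]; exact hnd
  have hadj : ∀ u v, G.Adj u v ↔ s(u, v) ∈ S := fun u v ↦ by
    rw [← SimpleGraph.mem_edgeSet, hGS]
  have : Finite G.edgeSet := by rw [hGS]; exact hfin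
  obtain ⟨⟨a, b⟩, hab⟩ := hne
  have hcyc := G.not_isAcyclic_of_exists_other_adj ((hadj a b).2 hab) (by
    rintro u w huw
    rw [hadj] at huw
    by_contra! hcon
    simp only [hadj] at hcon
    have hsing := degreeModTwo_singleton (gridAdj_of_mem_gridEdges (hgrid huw)) u
    have huw' : u ≠ w := by
      rintro rfl
      simpa [GridAdj] using gridAdj_of_mem_gridEdges (hgrid huw)
    have heq : ∀ w', modTwoIndicator S s(u, w') = modTwoIndicator {s(u, w)} s(u, w') := by
      intro w'
      by_cases hw : w' = w
      · rw [hw, modTwoIndicator_eq_one.2 huw, modTwoIndicator_eq_one.2 (Set.mem_singleton _)]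
      · rw [modTwoIndicator_eq_zero.2 (hcon w' hw), modTwoIndicator_eq_zero.2]
        simpa [hw] using fun h _ ↦ huw' h
    have h1 : degreeModTwo S u = degreeModTwo {s(u, w)} u := by
      have e1 : horizontalEdge (u.1 - 1) u.2 = s(u, (u.1 - 1, u.2)) := by
        rw [horizontalEdge, Sym2.eq_swap, sub_add_cancel]
      have e2 : verticalEdge u.1 (u.2 - 1) = s(u, (u.1, u.2 - 1)) := by
        rw [verticalEdge, Sym2.eq_swap, sub_add_cancel]
      have e3 : horizontalEdge u.1 u.2 = s(u, (u.1 + 1, u.2)) := rfl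
      have e4 : verticalEdge u.1 u.2 = s(u, (u.1, u.2 + 1)) := rfl
      simp only [degreeModTwo, e1, e2, e3, e4, heq]
    rw [hS, hsing] at h1
    simp [huw'] at h1)
  rw [SimpleGraph.IsAcyclic] at hcyc
  push Not at hcyc
  obtain ⟨v, p, hp⟩ := hcyc
  obtain ⟨C, hC⟩ := hp.exists_gridCycle
    (fun u v huv ↦ gridAdj_of_mem_gridEdges (hgrid ((hadj u v).1 huv)))
  exact ⟨C.edgeSet, hGS ▸ hC, C, rfl⟩

end ExistsCycle

section SquareBoundary

theorem squareEdges_mk (x y : ℤ) : squareEdges (x, y) =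
    {horizontalEdge x y, verticalEdge (x + 1) y, horizontalEdge x (y + 1), verticalEdge x y} := by
  have h1 : s((x + 1, y + 1), (x, y + 1)) = horizontalEdge x (y + 1) := Sym2.eq_swap
  have h2 : s((x, y + 1), (x, y)) = verticalEdge x y := Sym2.eq_swap
  simp [squareEdges, h1, h2, horizontalEdge, verticalEdge]

theorem horizontalEdge_mem_squareEdges {x y : ℤ} {z : GridV} :
    horizontalEdge x y ∈ squareEdges z ↔ z = (x, y) ∨ z = (x, y - 1) := by
  obtain ⟨a, b⟩ := z
  simp only [squareEdges_mk, Set.mem_insert_iff, Set.mem_singleton_iff, horizontalEdge_inj,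
    horizontalEdge_ne_verticalEdge, Prod.mk.injEq, or_false, false_or]
  omega

theorem verticalEdge_mem_squareEdges {x y : ℤ} {z : GridV} :
    verticalEdge x y ∈ squareEdges z ↔ z = (x, y) ∨ z = (x - 1, y) := by
  obtain ⟨a, b⟩ := z
  simp only [squareEdges_mk, Set.mem_insert_iff, Set.mem_singleton_iff, verticalEdge_inj,
    verticalEdge_ne_horizontalEdge, Prod.mk.injEq, false_or]
  omega

theorem squareEdges_subset_gridEdges (z : GridV) : squareEdges z ⊆ gridEdges := by
  obtain ⟨x, y⟩ := z
  rw [squareEdges_mk]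
  rintro e (rfl | rfl | rfl | rfl)
  exacts [horizontalEdge_mem_gridEdges _ _, verticalEdge_mem_gridEdges _ _,
    horizontalEdge_mem_gridEdges _ _, verticalEdge_mem_gridEdges _ _]

/-- The edges separating a square of `A` from a square outside `A`. -/
def squareBoundary (A : Set GridV) : Set (Sym2 GridV) :=
  {e | ∃ z ∈ A, ∃ w ∉ A, e ∈ squareEdges z ∧ e ∈ squareEdges w}

theorem squareBoundary_subset_gridEdges (A : Set GridV) : squareBoundary A ⊆ gridEdges :=
  fun _ ⟨_, _, _, _, h, _⟩ ↦ squareEdges_subset_gridEdges _ h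

theorem finite_squareBoundary {A : Set GridV} (hA : A.Finite) : (squareBoundary A).Finite := by
  refine (hA.biUnion (t := squareEdges) fun z _ ↦ by simp [squareEdges]).subset ?_
  rintro e ⟨z, hz, _, _, he, _⟩
  exact Set.mem_biUnion hz he

theorem squareBoundary_empty : squareBoundary ∅ = ∅ := by
  simp [squareBoundary]

theorem modTwoIndicator_squareBoundary {A : Set GridV} {e : Sym2 GridV} {a b : GridV}
    (h : ∀ z, e ∈ squareEdges z ↔ z = a ∨ z = b) :
    modTwoIndicator (squareBoundary A) e = modTwoIndicator A a + modTwoIndicator A b := by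
  have : e ∈ squareBoundary A ↔ (a ∈ A ∧ b ∉ A) ∨ (b ∈ A ∧ a ∉ A) := by
    simp only [squareBoundary, Set.mem_ofPred_eq, h]
    constructor
    · rintro ⟨z, hz, w, hw, rfl | rfl, rfl | rfl⟩ <;> tauto
    · rintro (⟨h1, h2⟩ | ⟨h1, h2⟩)
      exacts [⟨a, h1, b, h2, .inl rfl, .inr rfl⟩, ⟨b, h1, a, h2, .inr rfl, .inl rfl⟩]
  by_cases ha : a ∈ A <;> by_cases hb : b ∈ A <;>
    simp [modTwoIndicator, this, ha, hb, CharTwo.add_self_eq_zero]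

theorem modTwoIndicator_squareBoundary_horizontalEdge (A : Set GridV) (x y : ℤ) :
    modTwoIndicator (squareBoundary A) (horizontalEdge x y) =
      modTwoIndicator A (x, y) + modTwoIndicator A (x, y - 1) :=
  modTwoIndicator_squareBoundary fun _ ↦ horizontalEdge_mem_squareEdges

theorem modTwoIndicator_squareBoundary_verticalEdge (A : Set GridV) (x y : ℤ) :
    modTwoIndicator (squareBoundary A) (verticalEdge x y) =
      modTwoIndicator A (x, y) + modTwoIndicator A (x - 1, y) :=
  modTwoIndicator_squareBoundary fun _ ↦ verticalEdge_mem_squareEdges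

theorem isEvenEdgeSet_squareBoundary (A : Set GridV) : IsEvenEdgeSet (squareBoundary A) := by
  rintro ⟨x, y⟩
  simp only [degreeModTwo, modTwoIndicator_squareBoundary_horizontalEdge,
    modTwoIndicator_squareBoundary_verticalEdge]
  have h : (2 : ZMod 2) = 0 := rfl
  linear_combination (modTwoIndicator A (x, y) + modTwoIndicator A (x, y - 1) +
    modTwoIndicator A (x - 1, y) + modTwoIndicator A (x - 1, y - 1)) * h

theorem eq_of_modTwoIndicator_eq_on_gridEdges {S T : Set (Sym2 GridV)} (hS : S ⊆ gridEdges)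
    (hT : T ⊆ gridEdges)
    (hh : ∀ x y, modTwoIndicator S (horizontalEdge x y) = modTwoIndicator T (horizontalEdge x y))
    (hv : ∀ x y, modTwoIndicator S (verticalEdge x y) = modTwoIndicator T (verticalEdge x y)) :
    S = T := by
  have key : ∀ e ∈ gridEdges, (e ∈ S ↔ e ∈ T) := by
    rintro e ⟨x, y, rfl | rfl⟩
    · rw [← modTwoIndicator_eq_one, hh, modTwoIndicator_eq_one]
    · rw [← modTwoIndicator_eq_one, hv, modTwoIndicator_eq_one]
  ext e
  exact ⟨fun he ↦ (key e (hS he)).1 he, fun he ↦ (key e (hT he)).2 he⟩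

theorem squareBoundary_symmDiff (A B : Set GridV) :
    squareBoundary (A ∆ B) = squareBoundary A ∆ squareBoundary B := by
  refine eq_of_modTwoIndicator_eq_on_gridEdges (squareBoundary_subset_gridEdges _) ?_ ?_ ?_
  · exact symmDiff_le_sup.trans (sup_le (squareBoundary_subset_gridEdges A)
      (squareBoundary_subset_gridEdges B))
  all_goals
    intro x y
    simp only [modTwoIndicator_squareBoundary_horizontalEdge, modTwoIndicator_symmDiff,
      modTwoIndicator_squareBoundary_verticalEdge]
    ring

/-- A set of squares is determined by its boundary and its membership at one square. -/
theorem eq_of_squareBoundary_eq {A B : Set GridV} (h : squareBoundary A = squareBoundary B)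
    {z : GridV} (hz : z ∈ A ↔ z ∈ B) : A = B := by
  set d : GridV → ZMod 2 := fun z ↦ modTwoIndicator A z + modTwoIndicator B z with hd
  have h2 : (2 : ZMod 2) = 0 := rfl
  have hdy : ∀ x y, d (x, y) = d (x, y - 1) := by
    intro x y
    have := modTwoIndicator_squareBoundary_horizontalEdge A x y
    rw [h, modTwoIndicator_squareBoundary_horizontalEdge] at this
    simp only [hd]
    linear_combination (modTwoIndicator A (x, y) - modTwoIndicator B (x, y - 1)) * h2 + this
  have hdx : ∀ x y, d (x, y) = d (x - 1, y) := by
    intro x y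
    have := modTwoIndicator_squareBoundary_verticalEdge A x y
    rw [h, modTwoIndicator_squareBoundary_verticalEdge] at this
    simp only [hd]
    linear_combination (modTwoIndicator A (x, y) - modTwoIndicator B (x - 1, y)) * h2 + this
  have hy : ∀ x y, d (x, y) = d (x, z.2) := by
    intro x y
    induction y using Int.inductionOn' (b := z.2) with
    | zero => rfl
    | succ k _ ih => rw [hdy, add_sub_cancel_right, ih]
    | pred k _ ih => rw [← hdy, ih]
  have hx : ∀ x, d (x, z.2) = d z := by
    intro x
    induction x using Int.inductionOn' (b := z.1) with
    | zero => rfl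
    | succ k _ ih => rw [hdx, add_sub_cancel_right, ih]
    | pred k _ ih => rw [← hdx, ih]
  have hz0 : d z = 0 := by
    by_cases hzA : z ∈ A
    · simp only [hd, modTwoIndicator_eq_one.2 hzA, modTwoIndicator_eq_one.2 (hz.1 hzA)]
      exact h2
    · simp [hd, modTwoIndicator_eq_zero.2 hzA, modTwoIndicator_eq_zero.2 (mt hz.2 hzA)]
  ext w
  have hw : d w = 0 := (hy w.1 w.2).trans ((hx w.1).trans hz0)
  rw [← modTwoIndicator_eq_one, ← modTwoIndicator_eq_one, CharTwo.add_eq_zero.1 hw]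

theorem squareBoundary_nonempty {A : Set GridV} (hA : A.Finite) (hne : A.Nonempty) :
    (squareBoundary A).Nonempty := by
  by_contra hcon
  rw [Set.not_nonempty_iff_eq_empty] at hcon
  obtain ⟨z, hz⟩ := hA.exists_notMem
  refine hne.ne_empty (eq_of_squareBoundary_eq (z := z) (hcon.trans squareBoundary_empty.symm) ?_)
  simp [hz]

/-- A finite even set of grid edges is the boundary of a finite set of squares. -/
theorem IsEvenEdgeSet.exists_finite_squareBoundary_eq {S : Set (Sym2 GridV)}
    (hS : IsEvenEdgeSet S) (hgrid : S ⊆ gridEdges) (hfin : S.Finite) :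
    ∃ A : Set GridV, A.Finite ∧ squareBoundary A = S := by
  have hbox : ({p : GridV | horizontalEdge p.1 p.2 ∈ S} ∪
      {p : GridV | verticalEdge p.1 p.2 ∈ S}).Finite := by
    refine Set.Finite.union ?_ ?_
    · refine hfin.preimage (f := fun p : GridV ↦ horizontalEdge p.1 p.2) ?_
      intro p _ q _ hpq
      exact Prod.ext_iff.2 (horizontalEdge_inj.1 hpq)
    · refine hfin.preimage (f := fun p : GridV ↦ verticalEdge p.1 p.2) ?_
      intro p _ q _ hpq
      exact Prod.ext_iff.2 (verticalEdge_inj.1 hpq)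
  obtain ⟨⟨a, b⟩, hab⟩ := hbox.bddBelow
  obtain ⟨⟨c, d⟩, hcd⟩ := hbox.bddAbove
  have hh : ∀ x y, (x < a ∨ c < x ∨ y < b ∨ d < y) →
      modTwoIndicator S (horizontalEdge x y) = 0 := by
    intro x y hxy
    rw [modTwoIndicator_eq_zero]
    intro hmem
    have h1 := hab (Or.inl hmem : (x, y) ∈ _)
    have h2 := hcd (Or.inl hmem : (x, y) ∈ _)
    simp only [Prod.mk_le_mk] at h1 h2
    omega
  have hv : ∀ x y, (x < a ∨ c < x ∨ y < b ∨ d < y) →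
      modTwoIndicator S (verticalEdge x y) = 0 := by
    intro x y hxy
    rw [modTwoIndicator_eq_zero]
    intro hmem
    have h1 := hab (Or.inr hmem : (x, y) ∈ _)
    have h2 := hcd (Or.inr hmem : (x, y) ∈ _)
    simp only [Prod.mk_le_mk] at h1 h2
    omega
  set g : ℤ → ℤ → ZMod 2 :=
    fun x y ↦ ∑ t ∈ Finset.Ioc x (c + 1), modTwoIndicator S (verticalEdge t y) with hg
  have two : (2 : ZMod 2) = 0 := rfl
  have g_right : ∀ x y, c < x → g x y = 0 := by
    intro x y hx
    simp [hg, Finset.Ioc_eq_empty (show ¬ x < c + 1 by omega)]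
  have g_row : ∀ x y, (y < b ∨ d < y) → g x y = 0 := fun x y hy ↦
    Finset.sum_eq_zero fun t _ ↦ hv t y (by tauto)
  have g_succ : ∀ x y, g x y = modTwoIndicator S (verticalEdge (x + 1) y) + g (x + 1) y := by
    intro x y
    rcases lt_or_ge x (c + 1) with hx | hx
    · have : Finset.Ioc x (c + 1) = insert (x + 1) (Finset.Ioc (x + 1) (c + 1)) := by
        ext t
        simp only [Finset.mem_Ioc, Finset.mem_insert]
        omega
      simp only [hg]
      rw [this, Finset.sum_insert (by simp)]
    · rw [g_right x y (by omega), g_right (x + 1) y (by omega), hv _ _ (by omega), add_zero]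
  have g_horizontal : ∀ x y, g x y + g x (y - 1) = modTwoIndicator S (horizontalEdge x y) := by
    intro x y
    rcases le_total x (c + 1) with hx | hx
    · induction x, hx using Int.leInductionDown with
      | base => rw [g_right _ _ (by omega), g_right _ _ (by omega), hh _ _ (by omega), add_zero]
      | pred x hx ih =>
        have he := hS (x, y)
        simp only [degreeModTwo] at he
        have e1 := g_succ (x - 1) y
        have e2 := g_succ (x - 1) (y - 1)
        rw [sub_add_cancel] at e1 e2
        linear_combination e1 + e2 + ih + he -
          modTwoIndicator S (horizontalEdge (x - 1) y) * two
    · rw [g_right _ _ (by omega), g_right _ _ (by omega), hh _ _ (by omega), add_zero]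
  have g_left : ∀ x y, x < a → g x y = 0 := by
    intro x y hx
    rcases le_total y (d + 1) with hy | hy
    · induction y, hy using Int.leInductionDown with
      | base => exact g_row _ _ (by omega)
      | pred y hy ih =>
        have := g_horizontal x y
        rwa [ih, zero_add, hh _ _ (by omega)] at this
    · exact g_row _ _ (by omega)
  have ind : ∀ x y, modTwoIndicator {z : GridV | g z.1 z.2 = 1} (x, y) = g x y := by
    intro x y
    have h01 : ∀ r : ZMod 2, r = 1 ∨ r = 0 := by decide
    rcases h01 (g x y) with h | h
    · rw [h, modTwoIndicator_eq_one]
      exact h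
    · rw [h, modTwoIndicator_eq_zero]
      simp [h]
  refine ⟨{z | g z.1 z.2 = 1}, ?_, ?_⟩
  · refine (Set.finite_Icc (a, b) (c, d)).subset ?_
    rintro ⟨x, y⟩ hz
    replace hz : g x y = 1 := hz
    by_contra hcon
    simp only [Set.mem_Icc, Prod.mk_le_mk] at hcon
    have : g x y = 0 := by
      by_cases h1 : x < a
      · exact g_left _ _ h1
      by_cases h2 : c < x
      · exact g_right _ _ h2
      exact g_row _ _ (by omega)
    simp [this] at hz
  · refine eq_of_modTwoIndicator_eq_on_gridEdges (squareBoundary_subset_gridEdges _) hgrid ?_ ?_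
    · intro x y
      rw [modTwoIndicator_squareBoundary_horizontalEdge, ind, ind, g_horizontal]
    · intro x y
      have := g_succ (x - 1) y
      rw [sub_add_cancel] at this
      rw [modTwoIndicator_squareBoundary_verticalEdge, ind, ind]
      linear_combination this + g x y * two

theorem IsCycle.exists_finite_squareBoundary_eq {E : Set (Sym2 GridV)} (h : IsCycle E) :
    ∃ A : Set GridV, A.Finite ∧ squareBoundary A = E :=
  h.isEvenEdgeSet.exists_finite_squareBoundary_eq h.subset_gridEdges h.finite

/-- Every square of a finite set is enclosed by some cycle in the boundary of that set. -/
theorem exists_isCycle_subset_squareBoundary {A : Set GridV} (hA : A.Finite) {z : GridV}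
    (hz : z ∈ A) : ∃ B : Set GridV, B.Finite ∧ z ∈ B ∧ IsCycle (squareBoundary B) ∧
      squareBoundary B ⊆ squareBoundary A := by
  induction hn : (squareBoundary A).ncard using Nat.strong_induction_on generalizing A with
  | _ n ih =>
  obtain ⟨C, hCA, hC⟩ := (isEvenEdgeSet_squareBoundary A).exists_isCycle_subset
    (squareBoundary_subset_gridEdges A) (finite_squareBoundary hA)
    (squareBoundary_nonempty hA ⟨z, hz⟩)
  obtain ⟨B, hB, rfl⟩ := hC.exists_finite_squareBoundary_eq
  by_cases hzB : z ∈ B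
  · exact ⟨B, hB, hzB, hC, hCA⟩
  have hbd : squareBoundary (A ∆ B) = squareBoundary A \ squareBoundary B := by
    rw [squareBoundary_symmDiff, symmDiff_of_ge hCA]
  obtain ⟨B', hB', hzB', hcyc, hsub⟩ := ih (squareBoundary (A ∆ B)).ncard
    (by
      rw [hbd, ← hn]
      refine Set.ncard_lt_ncard ?_ (finite_squareBoundary hA)
      obtain ⟨e, he⟩ := hC.nonempty
      exact ⟨Set.sdiff_subset, fun h ↦ (h (hCA he)).2 he⟩)
    (hA.symmDiff hB) (Or.inl ⟨hz, hzB⟩) rfl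
  exact ⟨B', hB', hzB', hcyc, hsub.trans (hbd ▸ Set.sdiff_subset)⟩

end SquareBoundary

section MaximalCycles

variable {A₁ A₂ : Set GridV} {z₁ z₂ : GridV}

/-- The boundary cycle of `A` is maximal, among the cycles with edges in `G` enclosing the square
`z`. -/
def IsMaximalBoundary (G : Set (Sym2 GridV)) (z : GridV) (A : Set GridV) : Prop :=
  A.Finite ∧ z ∈ A ∧ IsCycle (squareBoundary A) ∧ squareBoundary A ⊆ G ∧
    ∀ B : Set GridV, B.Finite → z ∈ B → IsCycle (squareBoundary B) → squareBoundary B ⊆ G →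
      ∀ e ∈ squareBoundary B, e ∈ squareBoundary A ∨ ∀ w, e ∈ squareEdges w → w ∈ A

theorem squareBoundary_union_subset (A B : Set GridV) :
    squareBoundary (A ∪ B) ⊆ squareBoundary A ∪ squareBoundary B := by
  rintro e ⟨z, hz | hz, w, hw, hez, hew⟩
  · exact Or.inl ⟨z, hz, w, fun h ↦ hw (Or.inl h), hez, hew⟩
  · exact Or.inr ⟨z, hz, w, fun h ↦ hw (Or.inr h), hez, hew⟩

theorem IsMaximalBoundary.subset_squareBoundary_union {G : Set (Sym2 GridV)}
    (h₁ : IsMaximalBoundary G z₁ A₁) (h₂ : IsMaximalBoundary G z₂ A₂) :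
    squareBoundary A₁ ⊆ squareBoundary (A₁ ∪ A₂) := by
  obtain ⟨hA₁, hz₁, hC₁, hG₁, hmax⟩ := h₁
  obtain ⟨hA₂, -, -, hG₂, -⟩ := h₂
  obtain ⟨B, hB, hzB, hC, hsub⟩ :=
    exists_isCycle_subset_squareBoundary (hA₁.union hA₂) (Or.inl hz₁)
  have hBA : squareBoundary B ⊆ squareBoundary A₁ := by
    intro e he
    refine (hmax B hB hzB hC ?_ e he).resolve_right fun hw ↦ ?_
    · exact hsub.trans ((squareBoundary_union_subset _ _).trans (Set.union_subset hG₁ hG₂))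
    · obtain ⟨z, -, w, hwA, -, hew⟩ := hsub he
      exact hwA (Or.inl (hw w hew))
  rwa [← hC₁.eq_of_subset hC hBA]

theorem IsMaximalBoundary.disjoint {G : Set (Sym2 GridV)}
    (h₁ : IsMaximalBoundary G z₁ A₁) (h₂ : IsMaximalBoundary G z₂ A₂)
    (hne : squareBoundary A₁ ≠ squareBoundary A₂) : Disjoint A₁ A₂ := by
  have hs₁ := h₁.subset_squareBoundary_union h₂
  have hs₂ := h₂.subset_squareBoundary_union h₁
  rw [Set.union_comm] at hs₂
  by_contra hcon
  rw [Set.not_disjoint_iff_nonempty_inter] at hcon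
  have outside : ∀ {A B : Set GridV}, squareBoundary A ⊆ squareBoundary (A ∪ B) →
      ∀ {e : Sym2 GridV} {z w : GridV}, z ∈ A ∩ B → e ∈ squareEdges z → e ∈ squareEdges w →
        w ∉ A → w ∉ B := by
    intro A B hAB e z w hz hez hew hwA hwB
    obtain ⟨a, ha, b, hb, hea, heb⟩ := hAB ⟨z, hz.1, w, hwA, hez, hew⟩
    have hgrid := squareEdges_subset_gridEdges _ hez
    have hzw : z ≠ w := fun h ↦ hwA (h ▸ hz.1)
    have : b = z ∨ b = w := by
      obtain ⟨x, y, rfl | rfl⟩ := hgrid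
      · rw [horizontalEdge_mem_squareEdges] at hez hew heb
        grind
      · rw [verticalEdge_mem_squareEdges] at hez hew heb
        grind
    rcases this with rfl | rfl
    · exact hb (Or.inl hz.1)
    · exact hb (Or.inr hwB)
  have hsub : squareBoundary (A₁ ∩ A₂) ⊆ squareBoundary A₁ ∩ squareBoundary A₂ := by
    rintro e ⟨z, hz, w, hw, hez, hew⟩
    have hw' : w ∉ A₁ ∧ w ∉ A₂ := by
      by_cases hwA : w ∈ A₁
      · have hwB : w ∉ A₂ := fun h ↦ hw ⟨hwA, h⟩
        exact ⟨outside (Set.union_comm A₁ A₂ ▸ hs₂) hz.symm hez hew hwB, hwB⟩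
      · exact ⟨hwA, outside hs₁ hz hez hew hwA⟩
    exact ⟨⟨z, hz.1, w, hw'.1, hez, hew⟩, ⟨z, hz.2, w, hw'.2, hez, hew⟩⟩
  have heven := isEvenEdgeSet_squareBoundary (A₁ ∩ A₂)
  have hnonempty := squareBoundary_nonempty (h₁.1.inter_of_left A₂) hcon
  exact hne ((h₁.2.2.1.eq_of_isEvenEdgeSet_subset heven (hsub.trans Set.inter_subset_left)
    hnonempty).symm.trans (h₂.2.2.1.eq_of_isEvenEdgeSet_subset heven
      (hsub.trans Set.inter_subset_right) hnonempty))

theorem IsMaximalBoundary.disjoint_squareBoundary {G : Set (Sym2 GridV)}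
    (h₁ : IsMaximalBoundary G z₁ A₁) (h₂ : IsMaximalBoundary G z₂ A₂) (hd : Disjoint A₁ A₂) :
    Disjoint (squareBoundary A₁) (squareBoundary A₂) := by
  have hs₁ := h₁.subset_squareBoundary_union h₂
  rw [Set.disjoint_left] at hd ⊢
  rintro e ⟨z, hz, w, hw, hez, hew⟩ ⟨z', hz', w', hw', hez', hew'⟩
  obtain ⟨a, ha, b, hb, hea, heb⟩ := hs₁ ⟨z, hz, w, hw, hez, hew⟩
  have hzz : z ≠ z' := fun h ↦ hd hz (h ▸ hz')
  have : b = z ∨ b = z' := by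
    obtain ⟨x, y, rfl | rfl⟩ := squareEdges_subset_gridEdges _ hez
    · rw [horizontalEdge_mem_squareEdges] at hez hez' heb
      grind
    · rw [verticalEdge_mem_squareEdges] at hez hez' heb
      grind
  rcases this with rfl | rfl
  · exact hb (Or.inl hz)
  · exact hb (Or.inr hz')

/-- Two edge-disjoint cycles sharing two vertices have a cycle in their union that uses edges of
both. -/
theorem IsCycle.exists_isCycle_inter_nonempty {E F : Set (Sym2 GridV)} (hE : IsCycle E)
    (hF : IsCycle F) (hEF : Disjoint E F) {u v : GridV} (hu : u ∈ vertexSetOf E ∩ vertexSetOf F)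
    (hv : v ∈ vertexSetOf E ∩ vertexSetOf F) (huv : u ≠ v) :
    ∃ M ⊆ E ∪ F, IsCycle M ∧ (M ∩ E).Nonempty ∧ (M ∩ F).Nonempty := by
  obtain ⟨P, hP, hPdeg⟩ := hE.exists_ssubset_degreeModTwo hu.1 hv.1 huv
  obtain ⟨Q, hQ, hQdeg⟩ := hF.exists_ssubset_degreeModTwo hu.2 hv.2 huv
  have hPQ : P ∆ Q = P ∪ Q := (hEF.mono hP.1 hQ.1).symmDiff_eq_sup
  have heven : IsEvenEdgeSet (P ∪ Q) := fun x ↦ by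
    rw [← hPQ, degreeModTwo_symmDiff, hPdeg, hQdeg, CharTwo.add_self_eq_zero]
  have hsub : P ∪ Q ⊆ E ∪ F := Set.union_subset_union hP.1 hQ.1
  have hPne : P.Nonempty := by
    by_contra hcon
    rw [Set.not_nonempty_iff_eq_empty] at hcon
    have := hPdeg u
    simp [hcon, degreeModTwo_empty, huv] at this
  obtain ⟨M, hM, hMc⟩ := heven.exists_isCycle_subset
    (hsub.trans (Set.union_subset hE.subset_gridEdges hF.subset_gridEdges))
    ((hE.finite.union hF.finite).subset hsub) (hPne.mono Set.subset_union_left)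
  have proper : ∀ {E F P Q : Set (Sym2 GridV)}, IsCycle F → Q ⊂ F → P ⊆ E → M ⊆ P ∪ Q →
      (M ∩ E).Nonempty := by
    intro E F P Q hF hQ hP hM
    by_contra hcon
    have hMQ : M ⊆ Q := fun e he ↦ (hM he).resolve_left fun h ↦ hcon ⟨e, he, hP h⟩
    exact hQ.2 (hF.eq_of_subset hMc (hMQ.trans hQ.1) ▸ hMQ)
  exact ⟨M, hM.trans hsub, hMc, proper hF hQ hP.1 hM,
    proper hE hP hQ.1 (hM.trans (Set.union_comm P Q).subset)⟩

theorem IsMaximalBoundary.subsingleton_inter_vertexSetOf {G : Set (Sym2 GridV)}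
    (h₁ : IsMaximalBoundary G z₁ A₁) (h₂ : IsMaximalBoundary G z₂ A₂) (hd : Disjoint A₁ A₂) :
    (vertexSetOf (squareBoundary A₁) ∩ vertexSetOf (squareBoundary A₂)).Subsingleton := by
  intro u hu v hv
  by_contra huv
  have hde := h₁.disjoint_squareBoundary h₂ hd
  obtain ⟨hA₁, hz₁, hC₁, hG₁, hmax⟩ := h₁
  obtain ⟨hA₂, -, hC₂, hG₂, -⟩ := h₂
  obtain ⟨M, hMsub, hM, ⟨e₁, heM₁, he₁⟩, ⟨e₂, heM₂, he₂⟩⟩ :=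
    hC₁.exists_isCycle_inter_nonempty hC₂ hde hu hv huv
  obtain ⟨B, hB, rfl⟩ := hM.exists_finite_squareBoundary_eq
  have enclosed : ∀ B' : Set GridV, B'.Finite → z₁ ∈ B' → IsCycle (squareBoundary B') →
      squareBoundary B' ⊆ squareBoundary A₁ ∪ squareBoundary A₂ →
      squareBoundary B' = squareBoundary A₁ := by
    intro B' hB' hz hC hsub
    refine hC₁.eq_of_subset hC fun e he ↦ ?_
    rcases hmax B' hB' hz hC (hsub.trans (Set.union_subset hG₁ hG₂)) e he with h | h
    · exact h
    · refine (hsub he).resolve_right ?_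
      rintro ⟨z, hz, -, -, hez, -⟩
      exact Set.disjoint_left.1 hd (h z hez) hz
  by_cases hzB : z₁ ∈ B
  · rw [enclosed B hB hzB hM hMsub] at heM₂
    exact Set.disjoint_left.1 hde heM₂ he₂
  · obtain ⟨B', hB', hzB', hC', hsub⟩ :=
      exists_isCycle_subset_squareBoundary (hA₁.symmDiff hB) (z := z₁) (Or.inl ⟨hz₁, hzB⟩)
    rw [squareBoundary_symmDiff] at hsub
    have heq := enclosed B' hB' hzB' hC' (hsub.trans (symmDiff_le_sup.trans
      (sup_le Set.subset_union_left hMsub)))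
    rw [heq] at hsub
    rcases hsub he₁ with h | h
    · exact h.2 heM₁
    · exact h.2 he₁

end MaximalCycles

section Plane

theorem mem_squareSet {x y : ℤ} {p : ℝ × ℝ} : p ∈ squareSet (x, y) ↔
    ((x : ℝ) - 1 / 2 ≤ p.1 ∧ p.1 ≤ x + 1 / 2) ∧ ((y : ℝ) - 1 / 2 ≤ p.2 ∧ p.2 ≤ y + 1 / 2) := by
  simp only [squareSet, Set.mem_Icc, Prod.le_def]
  tauto

theorem mem_edgeSeg_horizontalEdge {x y : ℤ} {p : ℝ × ℝ} : p ∈ edgeSeg (horizontalEdge x y) ↔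
    p.2 = y - 1 / 2 ∧ (x : ℝ) - 1 / 2 ≤ p.1 ∧ p.1 ≤ x + 1 / 2 := by
  have h : edgeSeg (horizontalEdge x y) = segment ℝ (toPlane (x, y)) (toPlane (x + 1, y)) := rfl
  rw [h, toPlane, toPlane, ← Prod.image_mk_segment_left, segment_eq_Icc (by push_cast; linarith)]
  obtain ⟨a, b⟩ := p
  simp only [Set.mem_image, Set.mem_Icc, Prod.mk.injEq, Int.cast_add, Int.cast_one]
  constructor
  · rintro ⟨c, ⟨h1, h2⟩, rfl, rfl⟩
    exact ⟨rfl, h1, by linarith⟩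
  · rintro ⟨rfl, h1, h2⟩
    exact ⟨a, ⟨h1, by linarith⟩, rfl, rfl⟩

theorem mem_edgeSeg_verticalEdge {x y : ℤ} {p : ℝ × ℝ} : p ∈ edgeSeg (verticalEdge x y) ↔
    p.1 = x - 1 / 2 ∧ (y : ℝ) - 1 / 2 ≤ p.2 ∧ p.2 ≤ y + 1 / 2 := by
  have h : edgeSeg (verticalEdge x y) = segment ℝ (toPlane (x, y)) (toPlane (x, y + 1)) := rfl
  rw [h, toPlane, toPlane, ← Prod.image_mk_segment_right, segment_eq_Icc (by push_cast; linarith)]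
  obtain ⟨a, b⟩ := p
  simp only [Set.mem_image, Set.mem_Icc, Prod.mk.injEq, Int.cast_add, Int.cast_one]
  constructor
  · rintro ⟨c, ⟨h1, h2⟩, rfl, rfl⟩
    exact ⟨rfl, h1, by linarith⟩
  · rintro ⟨rfl, h1, h2⟩
    exact ⟨b, ⟨h1, by linarith⟩, rfl, rfl⟩

theorem mem_carrierOf {E : Set (Sym2 GridV)} {p : ℝ × ℝ} :
    p ∈ carrierOf E ↔ ∃ e ∈ E, p ∈ edgeSeg e := by
  simp [carrierOf]

theorem exists_mem_squareSet (p : ℝ × ℝ) : ∃ z, p ∈ squareSet z := by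
  refine ⟨(round p.1, round p.2), mem_squareSet.2 ?_⟩
  have h1 := abs_le.1 (abs_sub_round p.1)
  have h2 := abs_le.1 (abs_sub_round p.2)
  refine ⟨⟨?_, ?_⟩, ?_, ?_⟩ <;> linarith

/-- The centre of the square of index `z`. -/
def squareCentre (z : GridV) : ℝ × ℝ := (z.1, z.2)

theorem squareCentre_mem_squareSet (z : GridV) : squareCentre z ∈ squareSet z := by
  refine mem_squareSet.2 ⟨⟨?_, ?_⟩, ?_, ?_⟩ <;> simp [squareCentre]

theorem edgeSeg_subset_squareSet {e : Sym2 GridV} {z : GridV} (h : e ∈ squareEdges z) :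
    edgeSeg e ⊆ squareSet z := by
  intro p hp
  obtain ⟨x, y, rfl | rfl⟩ := squareEdges_subset_gridEdges z h
  · rw [mem_edgeSeg_horizontalEdge] at hp
    rcases horizontalEdge_mem_squareEdges.1 h with rfl | rfl <;> rw [mem_squareSet] <;>
      push_cast <;> refine ⟨⟨?_, ?_⟩, ?_, ?_⟩ <;> linarith
  · rw [mem_edgeSeg_verticalEdge] at hp
    rcases verticalEdge_mem_squareEdges.1 h with rfl | rfl <;> rw [mem_squareSet] <;>
      push_cast <;> refine ⟨⟨?_, ?_⟩, ?_, ?_⟩ <;> linarith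

theorem Int.not_cast_sub_half_mem_Ioo (x a : ℤ) :
    ¬ ((a : ℝ) - 1 / 2 < x - 1 / 2 ∧ (x : ℝ) - 1 / 2 < a + 1 / 2) := by
  rintro ⟨h1, h2⟩
  have h3 : (a : ℝ) < x := by linarith
  have h4 : (x : ℝ) < a + 1 := by linarith
  norm_cast at h3 h4
  omega

/-- The interior of a square does not meet the grid lines. -/
theorem notMem_carrierOf_of_mem_interior {E : Set (Sym2 GridV)} (hE : E ⊆ gridEdges) {z : GridV}
    {p : ℝ × ℝ} (h1 : (z.1 : ℝ) - 1 / 2 < p.1 ∧ p.1 < z.1 + 1 / 2)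
    (h2 : (z.2 : ℝ) - 1 / 2 < p.2 ∧ p.2 < z.2 + 1 / 2) : p ∉ carrierOf E := by
  rw [mem_carrierOf]
  rintro ⟨e, he, hp⟩
  obtain ⟨x, y, rfl | rfl⟩ := hE he
  · rw [mem_edgeSeg_horizontalEdge] at hp
    exact Int.not_cast_sub_half_mem_Ioo y z.2 (hp.1 ▸ h2)
  · rw [mem_edgeSeg_verticalEdge] at hp
    exact Int.not_cast_sub_half_mem_Ioo x z.1 (hp.1 ▸ h1)

theorem squareCentre_notMem_carrierOf {E : Set (Sym2 GridV)} (hE : E ⊆ gridEdges) (z : GridV) :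
    squareCentre z ∉ carrierOf E := by
  refine notMem_carrierOf_of_mem_interior hE (z := z) ⟨?_, ?_⟩ ⟨?_, ?_⟩ <;> simp [squareCentre]

theorem mem_iff_mem_of_mem_edgeSeg {A : Set GridV} {p : ℝ × ℝ}
    (hp : p ∉ carrierOf (squareBoundary A)) {e : Sym2 GridV} {z w : GridV}
    (hz : e ∈ squareEdges z) (hw : e ∈ squareEdges w) (he : p ∈ edgeSeg e) : z ∈ A ↔ w ∈ A := by
  by_contra hcon
  refine hp (mem_carrierOf.2 ⟨e, ?_, he⟩)
  by_cases hzA : z ∈ A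
  · exact ⟨z, hzA, w, by tauto, hz, hw⟩
  · exact ⟨w, by tauto, z, hzA, hw, hz⟩

theorem Int.eq_or_eq_add_one_of_mem_Icc {a b : ℤ} {t : ℝ}
    (ha : (a : ℝ) - 1 / 2 ≤ t ∧ t ≤ a + 1 / 2) (hb : (b : ℝ) - 1 / 2 ≤ t ∧ t ≤ b + 1 / 2) :
    a = b ∨ a = b + 1 ∨ b = a + 1 := by
  have h1 : (a : ℝ) ≤ b + 1 := by linarith
  have h2 : (b : ℝ) ≤ a + 1 := by linarith
  norm_cast at h1 h2
  omega

/-- Away from the boundary of `A`, squares with a common point are all in `A` or all outside. -/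
theorem mem_iff_mem_of_mem_squareSet {A : Set GridV} {p : ℝ × ℝ}
    (hp : p ∉ carrierOf (squareBoundary A)) {z w : GridV} (hz : p ∈ squareSet z)
    (hw : p ∈ squareSet w) : z ∈ A ↔ w ∈ A := by
  obtain ⟨x, y⟩ := z
  obtain ⟨a, b⟩ := w
  rw [mem_squareSet] at hz hw
  have hhor : ∀ {x y a : ℤ}, p ∈ squareSet (x, y) → p ∈ squareSet (a, y) → a = x + 1 →
      ((x, y) ∈ A ↔ (a, y) ∈ A) := by
    rintro x y _ h1 h2 rfl
    rw [mem_squareSet] at h1 h2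
    push_cast at h2
    refine mem_iff_mem_of_mem_edgeSeg hp (e := verticalEdge (x + 1) y)
      (verticalEdge_mem_squareEdges.2 (by simp)) (verticalEdge_mem_squareEdges.2 (by simp))
      (mem_edgeSeg_verticalEdge.2 ?_)
    push_cast
    exact ⟨by linarith, h1.2⟩
  have hver : ∀ {x y b : ℤ}, p ∈ squareSet (x, y) → p ∈ squareSet (x, b) → b = y + 1 →
      ((x, y) ∈ A ↔ (x, b) ∈ A) := by
    rintro x y _ h1 h2 rfl
    rw [mem_squareSet] at h1 h2
    push_cast at h2
    refine mem_iff_mem_of_mem_edgeSeg hp (e := horizontalEdge x (y + 1))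
      (horizontalEdge_mem_squareEdges.2 (by simp)) (horizontalEdge_mem_squareEdges.2 (by simp))
      (mem_edgeSeg_horizontalEdge.2 ?_)
    push_cast
    exact ⟨by linarith, h1.1⟩
  have h1 : p ∈ squareSet (x, y) := mem_squareSet.2 hz
  have h2 : p ∈ squareSet (a, y) := mem_squareSet.2 ⟨hw.1, hz.2⟩
  have h3 : p ∈ squareSet (a, b) := mem_squareSet.2 hw
  have h4 : (x, y) ∈ A ↔ (a, y) ∈ A := by
    rcases Int.eq_or_eq_add_one_of_mem_Icc hz.1 hw.1 with rfl | h | h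
    · rfl
    · exact (hhor h2 h1 h).symm
    · exact hhor h1 h2 h
  refine h4.trans ?_
  rcases Int.eq_or_eq_add_one_of_mem_Icc hz.2 hw.2 with rfl | h | h
  · rfl
  · exact (hver h3 h2 h).symm
  · exact hver h2 h3 h

theorem isClosed_squareSet (z : GridV) : IsClosed (squareSet z) := isClosed_Icc

theorem locallyFinite_squareSet : LocallyFinite squareSet := by
  intro p
  refine ⟨Metric.closedBall p 1, Metric.closedBall_mem_nhds p one_pos, ?_⟩
  refine (Set.finite_Icc (⌊p.1⌋ - 3, ⌊p.2⌋ - 3) (⌊p.1⌋ + 3, ⌊p.2⌋ + 3)).subset ?_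
  rintro ⟨x, y⟩ ⟨q, hq, hqp⟩
  rw [mem_squareSet] at hq
  rw [Metric.mem_closedBall, Prod.dist_eq, max_le_iff, Real.dist_eq, Real.dist_eq, abs_le,
    abs_le] at hqp
  have h1 := Int.floor_le p.1
  have h2 := Int.lt_floor_add_one p.1
  have h3 := Int.floor_le p.2
  have h4 := Int.lt_floor_add_one p.2
  rw [Set.mem_Icc, Prod.mk_le_mk, Prod.mk_le_mk]
  refine ⟨⟨?_, ?_⟩, ?_, ?_⟩ <;> rify <;> linarith

theorem isClosed_biUnion_squareSet (A : Set GridV) : IsClosed (⋃ z ∈ A, squareSet z) := by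
  rw [Set.biUnion_eq_iUnion]
  exact (locallyFinite_squareSet.comp_injective Subtype.val_injective).isClosed_iUnion
    fun z ↦ isClosed_squareSet z.1

theorem mem_interiorOf_squareBoundary {A : Set GridV} (hA : A.Finite) {z : GridV} (hz : z ∈ A)
    {p : ℝ × ℝ} (hp : p ∈ squareSet z) (hpA : p ∉ carrierOf (squareBoundary A)) :
    p ∈ interiorOf (squareBoundary A) := by
  refine ⟨hpA, Bornology.IsBounded.subset (t := ⋃ z ∈ A, squareSet z)
    ((Bornology.isBounded_biUnion hA).2 fun z _ ↦ Metric.isBounded_Icc _ _) ?_⟩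
  have hpre := isPreconnected_connectedComponentIn (F := (carrierOf (squareBoundary A))ᶜ) (x := p)
  have hsub := connectedComponentIn_subset (carrierOf (squareBoundary A))ᶜ p
  rw [isPreconnected_closed_iff] at hpre
  intro q hq
  by_contra hqA
  obtain ⟨w, hqw⟩ := exists_mem_squareSet q
  have hw : w ∉ A := fun hw ↦ hqA (Set.mem_biUnion hw hqw)
  have hcover : ∀ r, r ∈ (⋃ z ∈ A, squareSet z) ∪ ⋃ z ∈ Aᶜ, squareSet z := by
    intro r
    obtain ⟨v, hrv⟩ := exists_mem_squareSet r
    by_cases hv : v ∈ A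
    · exact .inl (Set.mem_biUnion hv hrv)
    · exact .inr (Set.mem_biUnion hv hrv)
  obtain ⟨r, hr, hrA, hrA'⟩ := hpre _ _ (isClosed_biUnion_squareSet A)
    (isClosed_biUnion_squareSet Aᶜ) (fun r _ ↦ hcover r)
    ⟨p, mem_connectedComponentIn hpA, Set.mem_biUnion hz hp⟩ ⟨q, hq, Set.mem_biUnion hw hqw⟩
  obtain ⟨u, hu, hru⟩ := Set.mem_iUnion₂.1 hrA
  obtain ⟨v, hv, hrv⟩ := Set.mem_iUnion₂.1 hrA'
  exact hv ((mem_iff_mem_of_mem_squareSet (hsub hr) hru hrv).1 hu)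

theorem inInterior_squareBoundary {A : Set GridV} (hA : A.Finite) {z : GridV} (hz : z ∈ A) :
    inInterior (squareBoundary A) (squareSet z) := by
  intro p hp
  by_cases hpA : p ∈ carrierOf (squareBoundary A)
  · exact .inr hpA
  · exact .inl (mem_interiorOf_squareBoundary hA hz hp hpA)

/-- The squares whose centre lies in the interior of `D`. -/
def interiorSquares (D : Set (Sym2 GridV)) : Set GridV := {z | squareCentre z ∈ interiorOf D}

theorem mem_interiorOf_iff_mem_interiorSquares {D : Set (Sym2 GridV)} (hD : D ⊆ gridEdges)
    {z : GridV} {p : ℝ × ℝ} (hp : p ∈ squareSet z) (hpD : p ∉ carrierOf D) :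
    p ∈ interiorOf D ↔ z ∈ interiorSquares D := by
  have hc := squareCentre_notMem_carrierOf hD z
  have hseg : segment ℝ (squareCentre z) p ⊆ (carrierOf D)ᶜ := by
    rw [segment_eq_image']
    rintro _ ⟨t, ⟨ht0, ht1⟩, rfl⟩
    rcases ht1.eq_or_lt with rfl | ht
    · simpa using hpD
    · have hp' := mem_squareSet.1 hp
      refine notMem_carrierOf_of_mem_interior hD (z := z) ?_ ?_ <;>
        simp only [squareCentre, Prod.fst_add, Prod.snd_add, Prod.smul_fst, Prod.smul_snd,
          Prod.fst_sub, Prod.snd_sub, smul_eq_mul] <;>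
        constructor <;> nlinarith
  have hmem : p ∈ connectedComponentIn (carrierOf D)ᶜ (squareCentre z) :=
    (convex_segment _ _).isPreconnected.subset_connectedComponentIn (left_mem_segment ℝ _ _) hseg
      (right_mem_segment ℝ _ _)
  have heq := connectedComponentIn_eq hmem
  simp only [interiorSquares, interiorOf, Set.mem_ofPred_eq, hpD, hc, not_false_eq_true, true_and,
    heq]

theorem exists_mem_edgeSeg_notMem_carrierOf {D : Set (Sym2 GridV)} (hD : D ⊆ gridEdges)
    {e : Sym2 GridV} (he : e ∈ gridEdges) (heD : e ∉ D) : ∃ p ∈ edgeSeg e, p ∉ carrierOf D := by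
  have hodd : ∀ a b : ℤ, (a : ℝ) ≠ b - 1 / 2 := by
    intro a b h
    have : (2 * a : ℝ) = 2 * b - 1 := by linarith
    norm_cast at this
    omega
  have heq : ∀ a b : ℤ, (a : ℝ) - 1 / 2 ≤ b → (b : ℝ) ≤ a + 1 / 2 → a = b := by
    intro a b h1 h2
    have h3 : (a : ℝ) < b + 1 := by linarith
    have h4 : (b : ℝ) < a + 1 := by linarith
    norm_cast at h3 h4
    omega
  obtain ⟨x, y, rfl | rfl⟩ := he
  · refine ⟨(x, y - 1 / 2), mem_edgeSeg_horizontalEdge.2 ⟨rfl, ?_, ?_⟩, ?_⟩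
    · simp
    · simp
    rw [mem_carrierOf]
    rintro ⟨e, he, hp⟩
    obtain ⟨a, b, rfl | rfl⟩ := hD he
    · rw [mem_edgeSeg_horizontalEdge] at hp
      obtain rfl : y = b := by exact_mod_cast sub_left_inj.1 hp.1
      obtain rfl := heq _ _ hp.2.1 hp.2.2
      exact heD he
    · rw [mem_edgeSeg_verticalEdge] at hp
      exact hodd _ _ hp.1
  · refine ⟨(x - 1 / 2, y), mem_edgeSeg_verticalEdge.2 ⟨rfl, ?_, ?_⟩, ?_⟩
    · simp
    · simp
    rw [mem_carrierOf]
    rintro ⟨e, he, hp⟩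
    obtain ⟨a, b, rfl | rfl⟩ := hD he
    · rw [mem_edgeSeg_horizontalEdge] at hp
      exact hodd _ _ hp.1
    · rw [mem_edgeSeg_verticalEdge] at hp
      obtain rfl : x = a := by exact_mod_cast sub_left_inj.1 hp.1
      obtain rfl := heq _ _ hp.2.1 hp.2.2
      exact heD he

theorem squareBoundary_interiorSquares_subset {D : Set (Sym2 GridV)} (hD : D ⊆ gridEdges) :
    squareBoundary (interiorSquares D) ⊆ D := by
  rintro e ⟨z, hz, w, hw, hez, hew⟩
  by_contra heD
  obtain ⟨p, hpe, hpD⟩ :=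
    exists_mem_edgeSeg_notMem_carrierOf hD (squareEdges_subset_gridEdges z hez) heD
  rw [← mem_interiorOf_iff_mem_interiorSquares hD (edgeSeg_subset_squareSet hez hpe) hpD] at hz
  rw [← mem_interiorOf_iff_mem_interiorSquares hD (edgeSeg_subset_squareSet hew hpe) hpD] at hw
  exact hw hz

theorem inInterior.mem_interiorSquares {D : Set (Sym2 GridV)} (hD : D ⊆ gridEdges) {z : GridV}
    (h : inInterior D (squareSet z)) : z ∈ interiorSquares D :=
  (h (squareCentre_mem_squareSet z)).resolve_right (squareCentre_notMem_carrierOf hD z)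

theorem inExterior.notMem_interiorSquares {D : Set (Sym2 GridV)} (hD : D ⊆ gridEdges) {z : GridV}
    (h : inExterior D (squareSet z)) : z ∉ interiorSquares D := fun hz ↦
  ((h (squareCentre_mem_squareSet z)).resolve_right (squareCentre_notMem_carrierOf hD z)).2 hz.2

theorem isOutermostCycleOf.squareBoundary_interiorSquares {ω : GridV → Prop} {z : GridV}
    {D : Set (Sym2 GridV)} (h : isOutermostCycleOf ω z D) :
    squareBoundary (interiorSquares D) = D := by
  obtain ⟨⟨hcyc, -⟩, -, hb, -⟩ := h
  have hD := hcyc.subset_gridEdges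
  refine (squareBoundary_interiorSquares_subset hD).antisymm fun e he ↦ ?_
  obtain ⟨⟨w, -, hew, hw⟩, w', -, hew', hw'⟩ := hb e he
  exact ⟨w, hw.mem_interiorSquares hD, w', hw'.notMem_interiorSquares hD, hew, hew'⟩

theorem isOutermostCycleOf.finite_interiorSquares {ω : GridV → Prop} {z : GridV}
    {D : Set (Sym2 GridV)} (h : isOutermostCycleOf ω z D) : (interiorSquares D).Finite := by
  have hcyc := h.1.1
  obtain ⟨A, hA, hAD⟩ := hcyc.exists_finite_squareBoundary_eq
  obtain ⟨e, he⟩ := hcyc.nonempty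
  obtain ⟨w, hw, -⟩ : e ∈ squareBoundary A := hAD ▸ he
  have hwI : w ∈ interiorSquares D := by
    have := (inInterior_squareBoundary hA hw)
    rw [hAD] at this
    exact this.mem_interiorSquares hcyc.subset_gridEdges
  rwa [← eq_of_squareBoundary_eq (hAD.trans h.squareBoundary_interiorSquares.symm) (z := w)
    (by simp [hw, hwI])]

theorem isOutermostCycleOf.isMaximalBoundary {ω : GridV → Prop} {z : GridV}
    {D : Set (Sym2 GridV)} (h : isOutermostCycleOf ω z D) :
    IsMaximalBoundary (gcEdges ω) z (interiorSquares D) := by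
  have hcyc := h.1.1
  have hD := hcyc.subset_gridEdges
  have hI := h.squareBoundary_interiorSquares
  refine ⟨h.finite_interiorSquares, h.2.1.mem_interiorSquares hD, by rwa [hI],
    by rw [hI]; exact h.1.2, fun B hB hzB hBc hBG e he ↦ ?_⟩
  rw [hI]
  by_cases heD : e ∈ D
  · exact .inl heD
  refine .inr fun w hw ↦ ?_
  have hin := (h.2.2.2 _ ⟨hBc, hBG⟩ (inInterior_squareBoundary hB hzB) e he).resolve_left heD
  obtain ⟨p, hpe, hpD⟩ := exists_mem_edgeSeg_notMem_carrierOf hD (hBc.subset_gridEdges he) heD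
  exact (mem_interiorOf_iff_mem_interiorSquares hD (edgeSeg_subset_squareSet hw hpe) hpD).1
    ((hin hpe).resolve_right hpD)

end Plane

/-- If `C(0)` is finite and nonempty and `S_{k₁}, S_{k₂} ∈ C(0)` have
distinct outermost boundary cycles `D_{k₁} ≠ D_{k₂}`, then `D_{k₁}` and `D_{k₂}` have
disjoint interiors and share at most one vertex. -/
theorem outermost_cycles_disjoint_interiors (ω : GridV → Prop)
    (hfin : (starComp ω).Finite) (hne : (starComp ω).Nonempty)
    (z₁ z₂ : GridV) (hz₁ : z₁ ∈ starComp ω) (hz₂ : z₂ ∈ starComp ω)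
    (D₁ D₂ : Set (Sym2 GridV))
    (hD₁ : isOutermostCycleOf ω z₁ D₁) (hD₂ : isOutermostCycleOf ω z₂ D₂)
    (hne' : D₁ ≠ D₂) :
    Disjoint (interiorOf D₁) (interiorOf D₂) ∧
      (vertexSetOf D₁ ∩ vertexSetOf D₂).Subsingleton := by

  have h₁ := hD₁.isMaximalBoundary
  have h₂ := hD₂.isMaximalBoundary
  have hI₁ := hD₁.squareBoundary_interiorSquares
  have hI₂ := hD₂.squareBoundary_interiorSquares
  have hdis := h₁.disjoint h₂ (by rwa [hI₁, hI₂])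
  refine ⟨Set.disjoint_left.2 fun p hp₁ hp₂ ↦ ?_, ?_⟩
  · obtain ⟨z, hz⟩ := exists_mem_squareSet p
    exact Set.disjoint_left.1 hdis
      ((mem_interiorOf_iff_mem_interiorSquares hD₁.1.1.subset_gridEdges hz hp₁.1).1 hp₁)
      ((mem_interiorOf_iff_mem_interiorSquares hD₂.1.1.subset_gridEdges hz hp₂.1).1 hp₂)
  · have := h₁.subsingleton_inter_vertexSetOf h₂ hdis
    rwa [hI₁, hI₂] at this
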